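/- Let Γ be a tail-triangle C-group of rank n+1 and set G_j := Γ_j ∩ Γ_n^P for 0 ≤ j ≤ n−1. Then: (i) G_j = ⟨α_0,…,α_{j−1},α_{j+1},…,α_{n−1}⟩ (the subgroup of Γ_n^P generated by all α_i with i ≠ j); (ii) every coset Γ_jμ (μ ∈ Γ) with Γ_jμ ∩ Γ_n^P ≠ ∅ can be written as Γ_jμ′ with μ′ ∈ Γ_n^P; (iii) for μ, ν ∈ Γ_n^P and 0 ≤ j ≤ k ≤ n−1 one has G_jμ = G_kν if and only if Γ_jμ = Γ_kν, and G_jμ ∩ G_kν ≠ ∅ if and only if Γ_jμ ∩ Γ_kν ≠ ∅. Hence the assignment G_jμ ↦ Γ_jμ is a well-defined, rank-preserving order isomorphism from the ranked poset of cosets {G_jμ : 0 ≤ j ≤ n−1, μ ∈ Γ_n^P} (ordered by j < k and nonempty intersection) onto the ranked poset of cosets {Γ_jμ : 0 ≤ j ≤ n−1, μ ∈ Γ_n^P}. -/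

import Mathlib

/-!
Tail-triangle C-groups (Monson–Schulte, "Semiregular Polytopes and Amalgamated C-groups").

A tail-triangle group of rank `n+1` (`n ≥ 2`) is a group `G` generated by involutions
`α 0, …, α (n-1), β` (where `β` plays the role of `β_{n-1}`), with the commutation
relations of the tail-triangle diagram, and it is a tail-triangle C-group if it moreover
satisfies the intersection condition on its distinguished generating family.
The generating family is indexed by `Set.Iic n ⊆ ℕ`, with index `i < n` corresponding
to `α i` and index `n` corresponding to `β`.
-/

namespace TailTriangle

variable {G : Type*} [Group G]

/-- The combined generating family: index `i < n` gives `α i`, index `n` (or beyond) gives `β`. -/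
def ttGens (n : ℕ) (α : ℕ → G) (β : G) : ℕ → G := fun i => if i < n then α i else β

/-- The intersection condition on the generating family, for subsets of the index set `Iic n`. -/
def ttInterCond (n : ℕ) (α : ℕ → G) (β : G) : Prop :=
  ∀ I J : Set ℕ, I ⊆ Set.Iic n → J ⊆ Set.Iic n →
    Subgroup.closure (ttGens n α β '' I) ⊓ Subgroup.closure (ttGens n α β '' J)
      = Subgroup.closure (ttGens n α β '' (I ∩ J))

/-- A tail-triangle group of rank `n+1`. -/
structure IsTailTriangleGroup (n : ℕ) (α : ℕ → G) (β : G) : Prop where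
  two_le : 2 ≤ n
  orderOf_α : ∀ i < n, orderOf (α i) = 2
  orderOf_β : orderOf β = 2
  comm_αα : ∀ i j : ℕ, i + 2 ≤ j → j < n → Commute (α i) (α j)
  comm_αβ : ∀ i : ℕ, i + 3 ≤ n → Commute (α i) β
  closure_eq_top : Subgroup.closure (ttGens n α β '' Set.Iic n) = ⊤

/-- A tail-triangle C-group: a tail-triangle group satisfying the intersection condition. -/
def IsTailTriangleCGroup (n : ℕ) (α : ℕ → G) (β : G) : Prop :=
  IsTailTriangleGroup n α β ∧ ttInterCond n α β

/-- The distinguished subgroup `Γ_j` of rank `j`, for `0 ≤ j ≤ n-1`: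
for `j ≤ n-2` it is generated by all generators except `α j`;
`Γ_{n-1}` is generated by `α 0, …, α (n-2)`. -/
def ttΓ (n : ℕ) (α : ℕ → G) (β : G) (j : ℕ) : Subgroup G :=
  if j = n - 1 then Subgroup.closure (ttGens n α β '' {i | i < n - 1})
  else Subgroup.closure (ttGens n α β '' {i | i ≤ n ∧ i ≠ j})

/-- `Γ_n^P = ⟨α 0, …, α (n-1)⟩`. -/
def ttΓP (n : ℕ) (α : ℕ → G) (β : G) : Subgroup G :=
  Subgroup.closure (ttGens n α β '' {i | i < n})

/-- `Γ_n^Q = ⟨α 0, …, α (n-2), β⟩`. -/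
def ttΓQ (n : ℕ) (α : ℕ → G) (β : G) : Subgroup G :=
  Subgroup.closure (ttGens n α β '' {i | i ≤ n ∧ i ≠ n - 1})

/-- The rank-`j` subgroup where the Boolean `P` chooses `Γ_n^P` (if `true`) or `Γ_n^Q`
(if `false`) at rank `n`. -/
def ttΓ' (n : ℕ) (α : ℕ → G) (β : G) (P : Bool) (j : ℕ) : Subgroup G :=
  if j = n then (if P then ttΓP n α β else ttΓQ n α β) else ttΓ n α β j

/-- The right coset `H μ = {h * μ : h ∈ H}`. -/
def rcoset (H : Subgroup G) (μ : G) : Set G := (· * μ) '' (H : Set G)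

theorem mem_rcoset {H : Subgroup G} {μ x : G} : x ∈ rcoset H μ ↔ x * μ⁻¹ ∈ H := by
  simp [rcoset]

theorem self_mem_rcoset (H : Subgroup G) (μ : G) : μ ∈ rcoset H μ := by
  simp [mem_rcoset]

theorem rcoset_eq_of_mem {H : Subgroup G} {μ ν : G} (h : ν ∈ rcoset H μ) :
    rcoset H μ = rcoset H ν := by
  rw [mem_rcoset] at h
  ext x
  rw [mem_rcoset, mem_rcoset, ← H.mul_mem_cancel_right (y := x * ν⁻¹) h]
  simp [mul_assoc]

theorem subgroup_eq_of_rcoset_eq {H K : Subgroup G} {μ ν : G} (h : rcoset H μ = rcoset K ν) :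
    H = K := by
  have hμ : μ ∈ rcoset K ν := h ▸ self_mem_rcoset H μ
  rw [rcoset_eq_of_mem hμ] at h
  ext x
  simpa [mem_rcoset] using Set.ext_iff.1 h (x * μ)

theorem rcoset_inter_coe {H P : Subgroup G} {μ : G} (hμ : μ ∈ P) :
    rcoset H μ ∩ P = rcoset (H ⊓ P) μ := by
  ext x
  simp [mem_rcoset, Subgroup.mem_inf, P.mul_mem_cancel_right (P.inv_mem hμ)]

/-- If every element of `K` is the product of an element of `K ⊓ P` and one of `H`, then
cosets of `H` and `K` with representatives in `P` that meet at all already meet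
in `P`. -/
theorem rcoset_inf_inter_nonempty {H K P : Subgroup G}
    (hK : ∀ x ∈ K, ∃ u ∈ K ⊓ P, ∃ v ∈ H, x = u * v) {μ ν : G} (hμ : μ ∈ P) (hν : ν ∈ P)
    (h : (rcoset H μ ∩ rcoset K ν).Nonempty) :
    (rcoset (H ⊓ P) μ ∩ rcoset (K ⊓ P) ν).Nonempty := by
  obtain ⟨x, hxμ, hxν⟩ := h
  rw [mem_rcoset] at hxμ hxν
  obtain ⟨u, ⟨huK, huP⟩, v, hv, huv⟩ := hK _ (K.inv_mem hxν)
  have huν : u⁻¹ * ν ∈ P := P.mul_mem (P.inv_mem huP) hν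
  have hvx : u⁻¹ * ν = v * x := by
    have : ν * x⁻¹ = u * v := by simpa using huv
    rw [← inv_mul_eq_iff_eq_mul, ← mul_assoc] at this
    rw [← this, inv_mul_cancel_right]
  refine ⟨u⁻¹ * ν, ?_, ?_⟩ <;> rw [mem_rcoset, Subgroup.mem_inf]
  · refine ⟨?_, P.mul_mem huν (P.inv_mem hμ)⟩
    rw [hvx, mul_assoc]
    exact H.mul_mem hv hxμ
  · rw [mul_inv_cancel_right]
    exact ⟨K.inv_mem huK, P.inv_mem huP⟩

theorem exists_mul_of_mem_closure_union {S T : Set G} (hST : ∀ s ∈ S, ∀ t ∈ T, Commute s t)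
    {x : G} (hx : x ∈ Subgroup.closure (S ∪ T)) :
    ∃ u ∈ Subgroup.closure S, ∃ v ∈ Subgroup.closure T, x = u * v := by
  have hT : Subgroup.closure T ≤ Subgroup.centralizer S :=
    (Subgroup.closure_le _).2 fun t ht => Subgroup.mem_centralizer_iff.2 fun s hs => hST s hs t ht
  have hS : Subgroup.closure S ≤ Subgroup.centralizer (Subgroup.closure T : Set G) :=
    (Subgroup.closure_le _).2 fun s hs => Subgroup.mem_centralizer_iff.2 fun t ht =>
      (Subgroup.mem_centralizer_iff.1 (hT ht) s hs).symm
  induction hx using Subgroup.closure_induction with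
  | mem x hx =>
    rcases hx with hx | hx
    · exact ⟨x, Subgroup.subset_closure hx, 1, one_mem _, (mul_one x).symm⟩
    · exact ⟨1, one_mem _, x, Subgroup.subset_closure hx, (one_mul x).symm⟩
  | one => exact ⟨1, one_mem _, 1, one_mem _, (one_mul 1).symm⟩
  | mul x y _ _ hx hy =>
    obtain ⟨u, hu, v, hv, rfl⟩ := hx
    obtain ⟨u', hu', v', hv', rfl⟩ := hy
    have hc : Commute v u' := Subgroup.mem_centralizer_iff.1 (hS hu') v hv
    exact ⟨u * u', mul_mem hu hu', v * v', mul_mem hv hv', hc.mul_mul_mul_comm u v'⟩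
  | inv x _ hx =>
    obtain ⟨u, hu, v, hv, rfl⟩ := hx
    have hc : Commute v u := Subgroup.mem_centralizer_iff.1 (hS hu) v hv
    refine ⟨u⁻¹, inv_mem hu, v⁻¹, inv_mem hv, ?_⟩
    rw [mul_inv_rev, hc.inv_inv.eq]

/-- The indices of the distinguished generators generating `ttΓ n α β j`. -/
def ttIdx (n j : ℕ) : Set ℕ := {i | i ≤ n ∧ i ≠ j ∧ (j = n - 1 → i < n)}

theorem ttΓ_eq_closure (n : ℕ) (α : ℕ → G) (β : G) (j : ℕ) :
    ttΓ n α β j = Subgroup.closure (ttGens n α β '' ttIdx n j) := by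
  unfold ttΓ
  split_ifs <;> congr 2 <;> ext i <;> simp only [ttIdx, Set.mem_ofPred_eq] <;> omega

theorem ttGens_image_of_lt {M : Type*} {n : ℕ} {α : ℕ → M} {β : M} {I : Set ℕ}
    (hI : ∀ i ∈ I, i < n) :
    ttGens n α β '' I = α '' I :=
  Set.image_congr fun i hi => if_pos (hI i hi)

theorem ttΓ_inf_ttΓP {n : ℕ} {α : ℕ → G} {β : G} (h : ttInterCond n α β) (j : ℕ) :
    ttΓ n α β j ⊓ ttΓP n α β = Subgroup.closure (α '' {i | i < n ∧ i ≠ j}) := by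
  rw [ttΓ_eq_closure, ttΓP, h _ {i | i < n} (fun i hi => hi.1) (fun i (hi : i < n) => hi.le),
    ← ttGens_image_of_lt (β := β) (I := {i | i < n ∧ i ≠ j}) fun i hi => hi.1]
  congr 2
  ext i
  simp only [ttIdx, Set.mem_inter_iff, Set.mem_ofPred_eq]
  omega

/-- The groups `Γ_j ⊓ Γ_n^P` are pairwise distinct. -/
theorem ttΓ_inf_ttΓP_injOn {n : ℕ} {α : ℕ → G} {β : G} (h : IsTailTriangleCGroup n α β)
    {j k : ℕ} (hk : k < n) (hjk : ttΓ n α β j ⊓ ttΓP n α β = ttΓ n α β k ⊓ ttΓP n α β) :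
    j = k := by
  by_contra hne
  have hmem : α k ∈ ttΓ n α β k ⊓ ttΓP n α β := by
    rw [← hjk, ttΓ_inf_ttΓP h.2]
    exact Subgroup.subset_closure ⟨k, ⟨hk, Ne.symm hne⟩, rfl⟩
  have hbot := h.2 (ttIdx n k) {k} (fun i hi => hi.1) (by simpa using hk.le)
  have hempty : ttIdx n k ∩ {k} = ∅ :=
    Set.inter_singleton_eq_empty.2 fun hkk => hkk.2.1 rfl
  rw [hempty, Set.image_empty, Subgroup.closure_empty, ← ttΓ_eq_closure] at hbot
  have hone : α k ∈ (⊥ : Subgroup G) :=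
    hbot ▸ ⟨hmem.1, Subgroup.subset_closure ⟨k, rfl, if_pos hk⟩⟩
  have hord := h.1.orderOf_α k hk
  rw [Subgroup.mem_bot.1 hone, orderOf_one] at hord
  omega

theorem IsTailTriangleGroup.commute_ttGens {n : ℕ} {α : ℕ → G} {β : G}
    (h : IsTailTriangleGroup n α β) {i k l : ℕ} (hk : k + 2 ≤ n) (hik : i < k) (hkl : k < l) :
    Commute (ttGens n α β i) (ttGens n α β l) := by
  have hi : ttGens n α β i = α i := if_pos (by omega)
  rw [hi]
  unfold ttGens
  split_ifs with hl
  · exact h.comm_αα i l (by omega) hl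
  · exact h.comm_αβ i (by omega)

/-- For `j ≤ k`, one has `Γ_k ⊆ (Γ_k ⊓ Γ_n^P) Γ_j`. -/
theorem IsTailTriangleGroup.exists_mul_of_mem_ttΓ {n : ℕ} {α : ℕ → G} {β : G}
    (h : IsTailTriangleGroup n α β) {j k : ℕ} (hjk : j ≤ k) (hk : k < n) {x : G}
    (hx : x ∈ ttΓ n α β k) :
    ∃ u ∈ ttΓ n α β k ⊓ ttΓP n α β, ∃ v ∈ ttΓ n α β j, x = u * v := by
  rcases hjk.eq_or_lt with rfl | hlt
  · exact ⟨1, one_mem _, x, hx, (one_mul x).symm⟩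
  rw [ttΓ_eq_closure] at hx
  by_cases hkn : k = n - 1
  · refine ⟨x, ⟨?_, ?_⟩, 1, one_mem _, (mul_one x).symm⟩
    · rwa [ttΓ_eq_closure]
    · exact Subgroup.closure_mono (Set.image_mono fun i hi => hi.2.2 hkn) hx
  have hidx : ttIdx n k = {i | i < k} ∪ {i | k < i ∧ i ≤ n} := by
    ext i
    simp only [ttIdx, Set.mem_union, Set.mem_ofPred_eq]
    omega
  rw [hidx, Set.image_union] at hx
  obtain ⟨u, hu, v, hv, rfl⟩ := exists_mul_of_mem_closure_union (by
    rintro _ ⟨i, hi, rfl⟩ _ ⟨l, hl, rfl⟩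
    exact h.commute_ttGens (by omega) hi hl.1) hx
  refine ⟨u, ⟨?_, ?_⟩, v, ?_, rfl⟩
  · rw [ttΓ_eq_closure, hidx]
    exact Subgroup.closure_mono (Set.image_mono Set.subset_union_left) hu
  · exact Subgroup.closure_mono (Set.image_mono fun i (hi : i < k) => hi.trans hk) hu
  · rw [ttΓ_eq_closure]
    refine Subgroup.closure_mono (Set.image_mono fun i hi => ?_) hv
    simp only [ttIdx, Set.mem_ofPred_eq] at hi ⊢
    omega

/-- Lemma `sects`(a) (facet structure): with `G_j := Γ_j ⊓ Γ_n^P`, one has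
(i) `G_j = ⟨α 0, …, α (j-1), α (j+1), …, α (n-1)⟩`;
(ii) every coset `Γ_j μ` meeting `Γ_n^P` has a representative in `Γ_n^P`;
(iii) for representatives in `Γ_n^P`, equality and incidence of the cosets `G_j μ`
match those of the cosets `Γ_j μ`.  Hence `G_j μ ↦ Γ_j μ` is a well-defined
rank-preserving order isomorphism between the corresponding ranked coset posets. -/
theorem facet_section_isomorphism
    (n : ℕ) (α : ℕ → G) (β : G) (h : IsTailTriangleCGroup n α β) :
    (∀ j < n, ttΓ n α β j ⊓ ttΓP n α β
        = Subgroup.closure (α '' {i | i < n ∧ i ≠ j})) ∧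
    (∀ j < n, ∀ μ : G, (rcoset (ttΓ n α β j) μ ∩ (ttΓP n α β : Set G)).Nonempty →
      ∃ μ' ∈ ttΓP n α β, rcoset (ttΓ n α β j) μ = rcoset (ttΓ n α β j) μ') ∧
    (∀ j k : ℕ, j ≤ k → k < n → ∀ μ ν : G, μ ∈ ttΓP n α β → ν ∈ ttΓP n α β →
      (rcoset (ttΓ n α β j ⊓ ttΓP n α β) μ = rcoset (ttΓ n α β k ⊓ ttΓP n α β) ν ↔
        rcoset (ttΓ n α β j) μ = rcoset (ttΓ n α β k) ν) ∧
      ((rcoset (ttΓ n α β j ⊓ ttΓP n α β) μ ∩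
          rcoset (ttΓ n α β k ⊓ ttΓP n α β) ν).Nonempty ↔
        (rcoset (ttΓ n α β j) μ ∩ rcoset (ttΓ n α β k) ν).Nonempty)) := by
  refine ⟨fun j _ => ttΓ_inf_ttΓP h.2 j, fun j _ μ => ?_,
    fun j k hjk hk μ ν hμ hν => ⟨⟨?_, ?_⟩, ?_, ?_⟩⟩
  · rintro ⟨μ', hμ', hP⟩
    exact ⟨μ', hP, rcoset_eq_of_mem hμ'⟩
  · intro heq
    obtain rfl := ttΓ_inf_ttΓP_injOn h hk (subgroup_eq_of_rcoset_eq heq)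
    have hmem := heq ▸ self_mem_rcoset _ ν
    rw [← rcoset_inter_coe hμ] at hmem
    exact rcoset_eq_of_mem hmem.1
  · intro heq
    rw [← rcoset_inter_coe hμ, ← rcoset_inter_coe hν, heq]
  · rw [← rcoset_inter_coe hμ, ← rcoset_inter_coe hν]
    exact Set.Nonempty.mono (Set.inter_subset_inter Set.inter_subset_left Set.inter_subset_left)
  · exact rcoset_inf_inter_nonempty (fun x hx => h.1.exists_mul_of_mem_ttΓ hjk hk hx) hμ hν
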